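/- arXiv:1102.5358 — 8 statements merged into one kernel-verified Lean document; each statement's English description precedes it below -/
import Mathlib

section
/- Let M ≥ 0 and let g : [0,1]×[0,1] → ℝ be continuously differentiable with |g(x,y)| ≤ M(x² + y²) and |(∂g/∂x)(x,y)| ≤ M(|x| + |y|) and |(∂g/∂y)(x,y)| ≤ M(|x| + |y|) for all (x,y) ∈ [0,1]×[0,1]. Then for every s ∈ (0,1]: |ξ^g(s)| ≤ 3M, and ξ^g is differentiable at every s ∈ (0,1) with |(ξ^g)′(s)| ≤ M·(3 − 2·log s). -/
open MeasureTheory Set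

lemma aux_int (a k : ℝ) (ha : 0 < a) (ha1 : a ≤ 1) :
    IntervalIntegrable (fun u : ℝ => 1 / u + k / u ^ 3) volume a 1 ∧
    IntervalIntegrable (fun u : ℝ => u + k / u ^ 3) volume a 1 := by
  have h0 : ∀ u ∈ uIcc a 1, u ≠ 0 := by
    intro u hu
    rw [uIcc_of_le ha1] at hu
    exact (lt_of_lt_of_le ha hu.1).ne'
  constructor
  · apply ContinuousOn.intervalIntegrable
    exact (continuousOn_const.div continuousOn_id h0).add
      (continuousOn_const.div (continuousOn_id.pow 3) (fun u hu => pow_ne_zero 3 (h0 u hu)))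
  · apply ContinuousOn.intervalIntegrable
    exact continuousOn_id.add
      (continuousOn_const.div (continuousOn_id.pow 3) (fun u hu => pow_ne_zero 3 (h0 u hu)))

lemma aux_log (a k : ℝ) (ha : 0 < a) (ha1 : a ≤ 1) :
    ∫ u in a..1, (1 / u + k / u ^ 3) = (- k / 2) - (Real.log a - k / (2 * a ^ 2)) := by
  have := intervalIntegral.integral_eq_sub_of_hasDerivAt
    (f := fun u : ℝ => Real.log u - k / 2 * (u ^ 2)⁻¹) (f' := fun u : ℝ => 1 / u + k / u ^ 3)
    (a := a) (b := 1) ?_ (aux_int a k ha ha1).1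
  · rw [this]
    simp
    field_simp
    try ring
  · intro u hu
    rw [uIcc_of_le ha1] at hu
    have hu0 : u ≠ 0 := (lt_of_lt_of_le ha hu.1).ne'
    have h := (Real.hasDerivAt_log hu0).sub
      (((hasDerivAt_pow 2 u).inv (pow_ne_zero 2 hu0)).const_mul (k / 2))
    refine h.congr_deriv ?_
    field_simp
    norm_num
    try ring

lemma aux_sq (a k : ℝ) (ha : 0 < a) (ha1 : a ≤ 1) :
    ∫ u in a..1, (u + k / u ^ 3) = (1 / 2 - k / 2) - (a ^ 2 / 2 - k / (2 * a ^ 2)) := by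
  have := intervalIntegral.integral_eq_sub_of_hasDerivAt
    (f := fun u : ℝ => u ^ 2 / 2 - k / 2 * (u ^ 2)⁻¹) (f' := fun u : ℝ => u + k / u ^ 3)
    (a := a) (b := 1) ?_ (aux_int a k ha ha1).2
  · rw [this]
    simp
    field_simp
  · intro u hu
    rw [uIcc_of_le ha1] at hu
    have hu0 : u ≠ 0 := (lt_of_lt_of_le ha hu.1).ne'
    have h := ((hasDerivAt_pow 2 u).div_const 2).sub
      (((hasDerivAt_pow 2 u).inv (pow_ne_zero 2 hu0)).const_mul (k / 2))
    refine h.congr_deriv ?_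
    field_simp
    norm_num
    try ring

/-- continuity of the integrand -/
lemma aux_cont (G : ℝ → ℝ → ℝ)
    (hc : ContinuousOn (fun p : ℝ × ℝ => G p.1 p.2) (Icc 0 1 ×ˢ Icc 0 1))
    (t : ℝ) (ht : 0 < t) : ContinuousOn (fun u => G u (t / u)) (Icc t 1) := by
  have h0 : ∀ u ∈ Icc t 1, u ≠ 0 := fun u hu => (lt_of_lt_of_le ht hu.1).ne'
  refine hc.comp (f := fun u => (u, t / u))
    (continuousOn_id.prodMk (continuousOn_const.div continuousOn_id h0)) ?_
  intro u hu
  have hu0 : 0 < u := lt_of_lt_of_le ht hu.1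
  exact ⟨⟨hu0.le, hu.2⟩, ⟨by positivity, (div_le_one hu0).2 hu.1⟩⟩

lemma aux_cont' (G : ℝ → ℝ → ℝ)
    (hc : ContinuousOn (fun p : ℝ × ℝ => G p.1 p.2) (Icc 0 1 ×ˢ Icc 0 1))
    (t : ℝ) (ht : 0 < t) : ContinuousOn (fun u => G u (t / u) * (1 / u)) (Icc t 1) := by
  have h0 : ∀ u ∈ Icc t 1, u ≠ 0 := fun u hu => (lt_of_lt_of_le ht hu.1).ne'
  exact (aux_cont G hc t ht).mul (continuousOn_const.div continuousOn_id h0)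

lemma aux_ii (f : ℝ → ℝ) (t : ℝ) (hf : ContinuousOn f (Icc t 1)) (a b : ℝ)
    (ha : a ∈ Icc t 1) (hb : b ∈ Icc t 1) : IntervalIntegrable f volume a b :=
  (hf.mono (uIcc_subset_Icc ha hb)).intervalIntegrable

lemma lemA (M : ℝ) (hM : 0 ≤ M) (G G01 : ℝ → ℝ → ℝ)
    (hdiff : ∀ x ∈ Icc (0:ℝ) 1, ∀ y ∈ Icc (0:ℝ) 1,
      HasDerivWithinAt (fun t => G x t) (G01 x y) (Icc 0 1) y)
    (hc : ContinuousOn (fun p : ℝ × ℝ => G p.1 p.2) (Icc 0 1 ×ˢ Icc 0 1))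
    (hc01 : ContinuousOn (fun p : ℝ × ℝ => G01 p.1 p.2) (Icc 0 1 ×ˢ Icc 0 1))
    (hbd : ∀ x ∈ Icc (0:ℝ) 1, ∀ y ∈ Icc (0:ℝ) 1, |G01 x y| ≤ M * (|x| + |y|))
    (c s : ℝ) (hc0 : 0 < c) (hc1 : c < 1) (hs : s = c * c) :
    ∃ d : ℝ, HasDerivAt (fun t => ∫ u in c..1, G u (t / u) * (1 / u)) d s ∧
      |d| ≤ M * (1 / 2 - Real.log s / 2) := by
  have hs0 : 0 < s := by rw [hs]; positivity
  have hsc : s < c := by rw [hs]; nlinarith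
  have hIoc : uIoc c 1 = Ioc c 1 := uIoc_of_le hc1.le
  have hmem : ∀ t ∈ Ioo 0 c, ∀ u ∈ Ioc c 1, 0 < t / u ∧ t / u < 1 := by
    intro t ht u hu
    have hu0 : 0 < u := hc0.trans hu.1
    exact ⟨div_pos ht.1 hu0, (div_lt_one hu0).2 (ht.2.trans hu.1)⟩
  have hN : Ioo 0 c ∈ nhds s := Ioo_mem_nhds hs0 hsc
  have hsub : ∀ t ∈ Ioo 0 c, Ioc c 1 ⊆ Icc t 1 := fun t ht u hu =>
    ⟨(ht.2.trans hu.1).le, hu.2⟩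
  have key := intervalIntegral.hasDerivAt_integral_of_dominated_loc_of_deriv_le
    (μ := volume) (a := c) (b := 1) (F := fun t u => G u (t / u) * (1 / u))
    (F' := fun t u => G01 u (t / u) * (1 / u) * (1 / u)) (x₀ := s) (s := Ioo 0 c)
    (bound := fun _ => M * 2 * (1 / c) * (1 / c)) hN ?_ ?_ ?_ ?_ ?_ ?_
  · refine ⟨_, key.2, ?_⟩
    have h2 : ‖∫ u in c..1, G01 u (s / u) * (1 / u) * (1 / u)‖ ≤
        ∫ u in c..1, M * (1 / u + s / u ^ 3) := by
      refine intervalIntegral.norm_integral_le_of_norm_le hc1.le ?_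
        ((aux_int c s hc0 hc1.le).1.const_mul M)
      refine Filter.Eventually.of_forall fun u hu => ?_
      have hu0 : 0 < u := hc0.trans hu.1
      have hy := hmem s ⟨hs0, hsc⟩ u hu
      have hb := hbd u ⟨hu0.le, hu.2⟩ (s / u) ⟨hy.1.le, hy.2.le⟩
      rw [abs_of_pos hu0, abs_of_pos hy.1] at hb
      rw [Real.norm_eq_abs, abs_mul, abs_mul, abs_of_pos (one_div_pos.2 hu0)]
      calc |G01 u (s / u)| * (1 / u) * (1 / u) ≤ M * (u + s / u) * (1 / u) * (1 / u) := by
            gcongr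
        _ = _ := by field_simp
    rw [intervalIntegral.integral_const_mul, aux_log c s hc0 hc1.le, Real.norm_eq_abs] at h2
    refine h2.trans (mul_le_mul_of_nonneg_left ?_ hM)
    have hl : Real.log s = 2 * Real.log c := by
      rw [hs, Real.log_mul hc0.ne' hc0.ne']; ring
    have : s / (2 * c ^ 2) = 1 / 2 := by rw [hs]; field_simp
    rw [hl, this]
    linarith
  · filter_upwards [hN] with t ht
    rw [hIoc]
    exact ((aux_cont' G hc t ht.1).mono (hsub t ht)).aestronglyMeasurable measurableSet_Ioc
  · exact aux_ii _ s (aux_cont' G hc s hs0) _ _ ⟨hsc.le, hc1.le⟩ ⟨(hsc.trans hc1).le, le_rfl⟩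
  · rw [hIoc]
    have h0 : ∀ u ∈ Icc s 1, u ≠ 0 := fun u hu => (lt_of_lt_of_le hs0 hu.1).ne'
    exact (((aux_cont' G01 hc01 s hs0).mul
      (continuousOn_const.div continuousOn_id h0)).mono
        (hsub s ⟨hs0, hsc⟩)).aestronglyMeasurable measurableSet_Ioc
  · refine Filter.Eventually.of_forall fun u hu t ht => ?_
    rw [hIoc] at hu
    have hu0 : 0 < u := hc0.trans hu.1
    have hy := hmem t ht u hu
    have hb := hbd u ⟨hu0.le, hu.2⟩ (t / u) ⟨hy.1.le, hy.2.le⟩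
    rw [abs_of_pos hu0, abs_of_pos hy.1] at hb
    rw [Real.norm_eq_abs, abs_mul, abs_mul, abs_of_pos (one_div_pos.2 hu0)]
    have h1 : |G01 u (t / u)| ≤ M * 2 :=
      hb.trans (mul_le_mul_of_nonneg_left (by linarith [hu.2, hy.2]) hM)
    have h2 : 1 / u ≤ 1 / c := one_div_le_one_div_of_le hc0 hu.1.le
    gcongr
  · exact intervalIntegrable_const
  · refine Filter.Eventually.of_forall fun u hu t ht => ?_
    rw [hIoc] at hu
    have hu0 : 0 < u := hc0.trans hu.1
    have hy := hmem t ht u hu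
    have hd := (hdiff u ⟨hu0.le, hu.2⟩ (t / u) ⟨hy.1.le, hy.2.le⟩).hasDerivAt
      (Icc_mem_nhds hy.1 hy.2)
    exact (hd.comp t ((hasDerivAt_id t).div_const u)).mul_const (1 / u)

lemma lemB (ψ : ℝ → ℝ → ℝ) (W : Set (ℝ × ℝ)) (hW : IsOpen W)
    (hψ : ContinuousOn (fun p : ℝ × ℝ => ψ p.1 p.2) W) (s c : ℝ) (hc0 : 0 < c)
    (hs : s = c * c) (hm : (s, c) ∈ W) :
    HasDerivAt (fun t => ∫ v in c..t / c, ψ t v) (ψ s c / c) s := by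
  have hsc : s / c = c := by rw [hs]; field_simp
  rw [hasDerivAt_iff_isLittleO, Asymptotics.isLittleO_iff]
  intro ε hε
  have hca := hψ.continuousAt (hW.mem_nhds hm)
  have hev : ∀ᶠ p : ℝ × ℝ in nhds (s, c), p ∈ W ∧ ‖ψ p.1 p.2 - ψ s c‖ < ε * c := by
    refine Filter.Eventually.and (hW.mem_nhds hm) ?_
    have := Metric.continuousAt_iff'.1 hca (ε * c) (by positivity)
    simpa [dist_eq_norm] using this
  obtain ⟨δ, hδ, hball⟩ := Metric.eventually_nhds_iff.1 hev
  have h1 : ∀ᶠ t in nhds s, |t / c - c| < δ := by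
    have : ContinuousAt (fun t : ℝ => t / c) s := by fun_prop
    have := Metric.continuousAt_iff'.1 this δ hδ
    simpa [Real.dist_eq, hsc] using this
  filter_upwards [h1, Metric.ball_mem_nhds s hδ] with t ht ht'
  have hp : ∀ v ∈ uIcc c (t / c), (t, v) ∈ W ∧ ‖ψ t v - ψ s c‖ < ε * c := by
    intro v hv
    refine @hball (t, v) ?_
    rw [Prod.dist_eq]
    refine max_lt ht' ?_
    have := abs_sub_left_of_mem_uIcc hv
    rw [Real.dist_eq]
    exact this.trans_lt ht
  have hint : IntervalIntegrable (fun v => ψ t v) volume c (t / c) := by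
    apply ContinuousOn.intervalIntegrable
    exact hψ.comp (f := fun v => (t, v)) (by fun_prop) (fun v hv => (hp v hv).1)
  have hn := intervalIntegral.norm_integral_le_of_norm_le_const
    (f := fun v => ψ t v - ψ s c) (a := c) (b := t / c) (C := ε * c)
    (fun v hv => (hp v (uIoc_subset_uIcc hv)).2.le)
  rw [intervalIntegral.integral_sub hint intervalIntegrable_const,
    intervalIntegral.integral_const] at hn
  have e1 : t / c - c = (t - s) / c := by rw [hs]; field_simp
  rw [e1, abs_div, abs_of_pos hc0] at hn
  simp only [hsc, intervalIntegral.integral_same, sub_zero, smul_eq_mul, Real.norm_eq_abs] at hn ⊢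
  calc _ = |(∫ v in c..t / c, ψ t v) - (t - s) / c * ψ s c| := by congr 2; ring
    _ ≤ _ := hn
    _ = _ := by field_simp

lemma lemSub (g : ℝ → ℝ → ℝ)
    (hc : ContinuousOn (fun p : ℝ × ℝ => g p.1 p.2) (Icc 0 1 ×ˢ Icc 0 1))
    (t c : ℝ) (ht0 : 0 < t) (htc : t < c) (hc1 : c < 1) :
    ∫ u in t..c, g u (t / u) * (1 / u) = ∫ v in t / c..1, g (t / v) v * (1 / v) := by
  have hc0 : 0 < c := ht0.trans htc
  have hle : t / c ≤ 1 := (div_le_one hc0).2 htc.le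
  have hpos : 0 < t / c := by positivity
  have hv0 : ∀ v ∈ uIcc (t / c) 1, 0 < v := by
    intro v hv
    rw [uIcc_of_le hle] at hv
    exact hpos.trans_le hv.1
  have := intervalIntegral.integral_comp_mul_deriv' (a := t / c) (b := 1)
    (f := fun v => t / v) (f' := fun v => - t / v ^ 2) (g := fun u => g u (t / u) * (1 / u))
    ?_ ?_ ?_
  · have e : t / (t / c) = c := by field_simp
    simp only [e, div_one] at this
    rw [intervalIntegral.integral_symm, ← this, ← intervalIntegral.integral_neg]
    apply intervalIntegral.integral_congr
    intro v hv
    have := hv0 v hv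
    have e2 : t / (t / v) = v := by field_simp
    simp only [Function.comp, e2]
    field_simp
  · intro v hv
    have h := (hasDerivAt_inv (hv0 v hv).ne').const_mul t
    simp only [← div_eq_mul_inv] at h
    refine h.congr_deriv ?_
    field_simp
  · exact continuousOn_const.div (continuousOn_id.pow 2) (fun v hv => pow_ne_zero 2 (hv0 v hv).ne')
  · refine (aux_cont' g hc t ht0).mono ?_
    rintro _ ⟨v, hv, rfl⟩
    have h0 := hv0 v hv
    rw [uIcc_of_le hle] at hv
    refine ⟨?_, ?_⟩
    · rw [le_div_iff₀ h0]; nlinarith [hv.2]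
    · rw [div_le_one h0]
      refine le_trans ?_ hv.1
      rw [le_div_iff₀ hc0]; nlinarith

/-- Bounds on `ξ^g` and its derivative for `g` of class `C¹` whose value and gradient
vanish to the appropriate order at the origin (proof of Lemma B.1 of the paper). -/
theorem stmt11
    (M : ℝ) (hM : 0 ≤ M)
    (g g10 g01 : ℝ → ℝ → ℝ)
    (hdiff : ∀ x ∈ Icc (0:ℝ) 1, ∀ y ∈ Icc (0:ℝ) 1,
      HasDerivWithinAt (fun t => g t y) (g10 x y) (Icc 0 1) x ∧
      HasDerivWithinAt (fun t => g x t) (g01 x y) (Icc 0 1) y)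
    (hc : ContinuousOn (fun p : ℝ × ℝ => g p.1 p.2) (Icc 0 1 ×ˢ Icc 0 1))
    (hc10 : ContinuousOn (fun p : ℝ × ℝ => g10 p.1 p.2) (Icc 0 1 ×ˢ Icc 0 1))
    (hc01 : ContinuousOn (fun p : ℝ × ℝ => g01 p.1 p.2) (Icc 0 1 ×ˢ Icc 0 1))
    (hbd : ∀ x ∈ Icc (0:ℝ) 1, ∀ y ∈ Icc (0:ℝ) 1,
      |g x y| ≤ M * (x ^ 2 + y ^ 2) ∧
      |g10 x y| ≤ M * (|x| + |y|) ∧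
      |g01 x y| ≤ M * (|x| + |y|)) :
    (∀ s ∈ Ioc (0:ℝ) 1, |∫ u in s..1, g u (s / u) * (1 / u)| ≤ 3 * M) ∧
    ∀ s ∈ Ioo (0:ℝ) 1, ∃ d : ℝ,
      HasDerivAt (fun t => ∫ u in t..1, g u (t / u) * (1 / u)) d s ∧
      |d| ≤ M * (3 - 2 * Real.log s) := by
  constructor
  · rintro s ⟨hs0, hs1⟩
    have h2 : ‖∫ u in s..1, g u (s / u) * (1 / u)‖ ≤ ∫ u in s..1, M * (u + s ^ 2 / u ^ 3) := by
      refine intervalIntegral.norm_integral_le_of_norm_le hs1 ?_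
        ((aux_int s (s ^ 2) hs0 hs1).2.const_mul M)
      refine Filter.Eventually.of_forall fun u hu => ?_
      have hu0 : 0 < u := hs0.trans hu.1
      have hb := (hbd u ⟨hu0.le, hu.2⟩ (s / u)
        ⟨by positivity, (div_le_one hu0).2 hu.1.le⟩).1
      rw [Real.norm_eq_abs, abs_mul, abs_of_pos (one_div_pos.2 hu0)]
      calc |g u (s / u)| * (1 / u) ≤ M * (u ^ 2 + (s / u) ^ 2) * (1 / u) := by gcongr
        _ = _ := by field_simp
    rw [intervalIntegral.integral_const_mul, aux_sq s (s ^ 2) hs0 hs1, Real.norm_eq_abs] at h2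
    refine h2.trans ?_
    rw [mul_comm 3 M]
    refine mul_le_mul_of_nonneg_left ?_ hM
    have : s ^ 2 / (2 * s ^ 2) = 1 / 2 := by field_simp
    rw [this]
    nlinarith [sq_nonneg s]
  · rintro s ⟨hs0, hs1⟩
    obtain ⟨c, hc0, hs⟩ : ∃ c : ℝ, 0 < c ∧ s = c * c :=
      ⟨Real.sqrt s, Real.sqrt_pos.2 hs0, (Real.mul_self_sqrt hs0.le).symm⟩
    have hc1 : c < 1 := by nlinarith
    have hsc : s < c := by nlinarith
    have hcs : ContinuousOn (fun p : ℝ × ℝ => g p.2 p.1) (Icc 0 1 ×ˢ Icc 0 1) :=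
      hc.comp (f := Prod.swap) continuous_swap.continuousOn (fun p hp => ⟨hp.2, hp.1⟩)
    have hcs' : ContinuousOn (fun p : ℝ × ℝ => g10 p.2 p.1) (Icc 0 1 ×ˢ Icc 0 1) :=
      hc10.comp (f := Prod.swap) continuous_swap.continuousOn (fun p hp => ⟨hp.2, hp.1⟩)
    obtain ⟨d1, hd1, hb1⟩ := lemA M hM g g01 (fun x hx y hy => (hdiff x hx y hy).2) hc hc01
      (fun x hx y hy => (hbd x hx y hy).2.2) c s hc0 hc1 hs
    obtain ⟨d2, hd2, hb2⟩ := lemA M hM (fun x y => g y x) (fun x y => g10 y x)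
      (fun x hx y hy => (hdiff y hy x hx).1) hcs hcs'
      (fun x hx y hy => by rw [add_comm]; exact (hbd y hy x hx).2.1) c s hc0 hc1 hs
    have hd3 := lemB (fun t v => g (t / v) v * (1 / v))
      {p : ℝ × ℝ | 0 < p.1 ∧ p.1 < p.2 ∧ p.2 < 1} ?_ ?_ s c hc0 hs ⟨hs0, hsc, hc1⟩
    · refine ⟨d1 + (d2 - g (s / c) c * (1 / c) / c), ?_, ?_⟩
      · refine (hd1.add (hd2.sub hd3)).congr_of_eventuallyEq ?_
        filter_upwards [Ioo_mem_nhds hs0 hsc] with t ht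
        have ht1 : t < 1 := ht.2.trans hc1
        have i1 := aux_cont' g hc t ht.1
        have i2 := aux_cont' (fun x y => g y x) hcs t ht.1
        have m1 : t ∈ Icc t 1 := ⟨le_rfl, ht1.le⟩
        have m2 : c ∈ Icc t 1 := ⟨ht.2.le, hc1.le⟩
        have m3 : (1:ℝ) ∈ Icc t 1 := ⟨ht1.le, le_rfl⟩
        have m4 : t / c ∈ Icc t 1 :=
          ⟨by rw [le_div_iff₀ hc0]; nlinarith [ht.1], (div_le_one hc0).2 ht.2.le⟩
        have e1 := intervalIntegral.integral_add_adjacent_intervals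
          (aux_ii _ t i1 t c m1 m2) (aux_ii _ t i1 c 1 m2 m3)
        have e2 := intervalIntegral.integral_add_adjacent_intervals
          (aux_ii _ t i2 c (t / c) m2 m4) (aux_ii _ t i2 (t / c) 1 m4 m3)
        have e3 := lemSub g hc t c ht.1 ht.2 hc1
        simp only [Pi.add_apply, Pi.sub_apply]
        rw [← e1, ← e2, e3]
        ring
      · have e : s / c = c := by rw [hs]; field_simp
        have hb := (hbd c ⟨hc0.le, hc1.le⟩ c ⟨hc0.le, hc1.le⟩).1
        have h3 : |g (s / c) c * (1 / c) / c| ≤ 2 * M := by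
          rw [e, abs_div, abs_mul, abs_of_pos hc0, abs_of_pos (one_div_pos.2 hc0)]
          calc |g c c| * (1 / c) / c ≤ M * (c ^ 2 + c ^ 2) * (1 / c) / c := by gcongr
            _ = _ := by field_simp; ring
        have hl : M * Real.log s ≤ 0 :=
          mul_nonpos_of_nonneg_of_nonpos hM (Real.log_nonpos hs0.le hs1.le)
        have t1 := abs_add_le d1 (d2 - g (s / c) c * (1 / c) / c)
        have t2 := abs_sub d2 (g (s / c) c * (1 / c) / c)
        nlinarith
    · exact (isOpen_lt continuous_const continuous_fst).inter
        ((isOpen_lt continuous_fst continuous_snd).inter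
          (isOpen_lt continuous_snd continuous_const))
    · have h0 : ∀ p ∈ {p : ℝ × ℝ | 0 < p.1 ∧ p.1 < p.2 ∧ p.2 < 1}, p.2 ≠ 0 :=
        fun p hp => (hp.1.trans hp.2.1).ne'
      refine ContinuousOn.mul ?_ (continuousOn_const.div continuousOn_snd h0)
      refine hc.comp (f := fun p : ℝ × ℝ => (p.1 / p.2, p.2))
        ((continuousOn_fst.div continuousOn_snd h0).prodMk continuousOn_snd) ?_
      rintro p ⟨h1, h2, h3⟩
      have h4 : 0 < p.2 := h1.trans h2
      exact ⟨⟨by positivity, (div_le_one h4).2 h2.le⟩, ⟨h4.le, h3.le⟩⟩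
end

section
/- Let ε ∈ (0,1], H ≥ 0, and let g : [0,1]×[0,1] → ℝ be twice continuously differentiable with |g(x,y)| ≤ H(x^{2+ε} + y^{2+ε}), |(∂g/∂x)(x,y)| ≤ H(x^{1+ε} + y^{1+ε}), |(∂g/∂y)(x,y)| ≤ H(x^{1+ε} + y^{1+ε}), |(∂²g/∂x²)(x,y)| ≤ H(x^{ε} + y^{ε}) and |(∂²g/∂y²)(x,y)| ≤ H(x^{ε} + y^{ε}) for all (x,y) ∈ [0,1]×[0,1]. Then ξ^g is twice differentiable on (0,1) and |(ξ^g)″(s)| ≤ 9H·s^{ε/2 − 1} for every s ∈ (0,1). -/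
open MeasureTheory Set

theorem leib_aux (F F' : ℝ → ℝ → ℝ) (s1 s2 c s0 : ℝ) (a : ℝ → ℝ) (a' : ℝ)
    (hs0 : s0 ∈ Ioo s1 s2) (ha0 : a s0 ∈ Ioo c 1) (ha : HasDerivAt a a' s0)
    (hF : ∀ s ∈ Ioo s1 s2, ∀ u ∈ Icc c 1, HasDerivAt (fun t => F t u) (F' s u) s)
    (cF : ContinuousOn (fun p : ℝ × ℝ => F p.1 p.2) (Icc s1 s2 ×ˢ Icc c 1))
    (cF' : ContinuousOn (fun p : ℝ × ℝ => F' p.1 p.2) (Icc s1 s2 ×ˢ Icc c 1)) :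
    HasDerivAt (fun s => ∫ u in (a s)..1, F s u)
      (- (F s0 (a s0) * a') + ∫ u in (a s0)..1, F' s0 u) s0 := by
  have sl : ∀ s ∈ Icc s1 s2, ContinuousOn (F s) (Icc c 1) := fun s hs =>
    cF.comp (f := fun u => (s, u)) (by fun_prop) (fun u hu => ⟨hs, hu⟩)
  have sl' : ∀ s ∈ Icc s1 s2, ContinuousOn (F' s) (Icc c 1) := fun s hs =>
    cF'.comp (f := fun u => (s, u)) (by fun_prop) (fun u hu => ⟨hs, hu⟩)
  have int : ∀ s ∈ Icc s1 s2, ∀ p ∈ Icc c 1, ∀ q ∈ Icc c 1, IntervalIntegrable (F s) volume p q := by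
    intro s hs p hp q hq
    exact ((sl s hs).mono (uIcc_subset_Icc hp hq)).intervalIntegrable
  have h1 : (1:ℝ) ∈ Icc c 1 := ⟨(ha0.1.trans ha0.2).le, le_rfl⟩
  have ha0' : a s0 ∈ Icc c 1 := Ioo_subset_Icc_self ha0
  have hs0' : s0 ∈ Icc s1 s2 := Ioo_subset_Icc_self hs0
  have hsub : uIoc (a s0) 1 ⊆ Icc c 1 := uIoc_subset_uIcc.trans (uIcc_subset_Icc ha0' h1)
  have hnh : Ioo s1 s2 ∈ nhds s0 := isOpen_Ioo.mem_nhds hs0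
  obtain ⟨M, hM⟩ := (isCompact_Icc.prod isCompact_Icc).exists_bound_of_continuousOn cF'
  have hM' : ∀ s ∈ Icc s1 s2, ∀ u ∈ Icc c 1, ‖F' s u‖ ≤ M := fun s hs u hu => hM (s, u) ⟨hs, hu⟩
  have A := (intervalIntegral.hasDerivAt_integral_of_dominated_loc_of_deriv_le (μ := volume)
    (a := a s0) (b := 1) (F := F) (F' := F') (x₀ := s0) (bound := fun _ => M) hnh
    (by
      filter_upwards [hnh] with s hs
      exact ((sl s (Ioo_subset_Icc_self hs)).mono hsub).aestronglyMeasurable measurableSet_uIoc)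
    (int s0 hs0' _ ha0' _ h1)
    (((sl' s0 hs0').mono hsub).aestronglyMeasurable measurableSet_uIoc)
    (Filter.Eventually.of_forall fun u hu s hs => hM' s (Ioo_subset_Icc_self hs) u (hsub hu))
    intervalIntegrable_const
    (Filter.Eventually.of_forall fun u hu s hs => hF s hs u (hsub hu))).2
  have B0 : HasDerivAt (fun x => ∫ u in (a s0)..x, F s0 u) (F s0 (a s0)) (a s0) := by
    have hc : ContinuousAt (F s0) (a s0) := (sl s0 hs0').continuousAt (Icc_mem_nhds ha0.1 ha0.2)
    refine intervalIntegral.integral_hasDerivAt_right (by simp) ?_ hc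
    exact ContinuousOn.stronglyMeasurableAtFilter isOpen_Ioo
      ((sl s0 hs0').mono Ioo_subset_Icc_self) _ ha0
  have B : HasDerivAt (fun s => ∫ u in (a s0)..(a s), F s0 u) (F s0 (a s0) * a') s0 :=
    B0.comp s0 ha
  have hev : ∀ᶠ s in nhds s0, a s ∈ Icc c 1 := 
    ha.continuousAt.eventually_mem (Icc_mem_nhds ha0.1 ha0.2)
  have C : HasDerivAt (fun s => ∫ u in (a s0)..(a s), (F s u - F s0 u)) 0 s0 := by
    rw [hasDerivAt_iff_isLittleO]
    simp only [intervalIntegral.integral_same, sub_zero, smul_zero]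
    have hb : ∀ᶠ s in nhds s0, ‖∫ u in (a s0)..(a s), (F s u - F s0 u)‖ ≤
        M * ‖(a s - a s0) * (s - s0)‖ := by
      filter_upwards [hnh, hev] with s hs has
      have := intervalIntegral.norm_integral_le_of_norm_le_const (a := a s0) (b := a s)
        (f := fun u => F s u - F s0 u) (C := M * ‖s - s0‖) (by
          intro u hu
          have hu' : u ∈ Icc c 1 := uIoc_subset_uIcc.trans (uIcc_subset_Icc ha0' has) hu
          exact (convex_Ioo s1 s2).norm_image_sub_le_of_norm_hasDerivWithin_le
            (f := fun t => F t u) (f' := fun t => F' t u)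
            (fun x hx => (hF x hx u hu').hasDerivWithinAt)
            (fun x hx => hM' x (Ioo_subset_Icc_self hx) u hu') hs0 hs)
      refine this.trans (le_of_eq ?_)
      rw [norm_mul, Real.norm_eq_abs (a s - a s0)]; ring
    refine (Asymptotics.IsBigO.of_bound M hb).trans_isLittleO ?_
    have : (fun s => a s - a s0) =o[nhds s0] (fun _ => (1:ℝ)) := by
      rw [Asymptotics.isLittleO_one_iff]
      have := ha.continuousAt.tendsto.sub_const (a s0)
      simpa using this
    simpa using this.mul_isBigO (Asymptotics.isBigO_refl (fun s => s - s0) (nhds s0))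
  have D := (A.sub B).sub C
  refine (D.congr_of_eventuallyEq ?_).congr_deriv (by ring)
  filter_upwards [hnh, hev] with s hs has
  have hs' := Ioo_subset_Icc_self hs
  simp only [Pi.sub_apply]
  rw [intervalIntegral.integral_sub (int s hs' _ ha0' _ has) (int s0 hs0' _ ha0' _ has)]
  rw [← intervalIntegral.integral_add_adjacent_intervals (int s hs' _ ha0' _ has) (int s hs' _ has _ h1)]
  ring

theorem diag_aux (g g10 g01 : ℝ → ℝ → ℝ)
    (hdiff : ∀ x ∈ Icc (0:ℝ) 1, ∀ y ∈ Icc (0:ℝ) 1,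
      HasDerivWithinAt (fun t => g t y) (g10 x y) (Icc 0 1) x ∧
      HasDerivWithinAt (fun t => g x t) (g01 x y) (Icc 0 1) y)
    (hc10 : ContinuousOn (fun p : ℝ × ℝ => g10 p.1 p.2) (Icc 0 1 ×ˢ Icc 0 1))
    (hc01 : ContinuousOn (fun p : ℝ × ℝ => g01 p.1 p.2) (Icc 0 1 ×ˢ Icc 0 1))
    (x : ℝ) (hx : x ∈ Ioo (0:ℝ) 1) :
    HasDerivAt (fun t => g t t) (g10 x x + g01 x x) x := by
  have hn : (Ioo (0:ℝ) 1 ×ˢ Ioo (0:ℝ) 1) ∈ nhds (x, x) := 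
    (isOpen_Ioo.prod isOpen_Ioo).mem_nhds ⟨hx, hx⟩
  have hn' : (Icc (0:ℝ) 1 ×ˢ Icc (0:ℝ) 1) ∈ nhds (x, x) :=
    Filter.mem_of_superset hn (prod_mono Ioo_subset_Icc_self Ioo_subset_Icc_self)
  have key := hasStrictFDerivAt_uncurry_coprod (𝕜 := ℝ) (u := (x, x)) (f := g)
    (f₁ := fun a b => ContinuousLinearMap.toSpanSingleton ℝ (g10 a b))
    (f₂ := fun a b => ContinuousLinearMap.toSpanSingleton ℝ (g01 a b))
    (by
      filter_upwards [hn] with v hv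
      exact ((hdiff v.1 (Ioo_subset_Icc_self hv.1) v.2 (Ioo_subset_Icc_self hv.2)).1.hasDerivAt
        (Icc_mem_nhds hv.1.1 hv.1.2)).hasFDerivAt)
    (by
      filter_upwards [hn] with v hv
      exact ((hdiff v.1 (Ioo_subset_Icc_self hv.1) v.2 (Ioo_subset_Icc_self hv.2)).2.hasDerivAt
        (Icc_mem_nhds hv.2.1 hv.2.2)).hasFDerivAt)
    ((ContinuousLinearMap.toSpanSingletonCLE (𝕜 := ℝ) (E := ℝ)).continuous.continuousAt.comp (hc10.continuousAt hn'))
    ((ContinuousLinearMap.toSpanSingletonCLE (𝕜 := ℝ) (E := ℝ)).continuous.continuousAt.comp (hc01.continuousAt hn'))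
  have := key.hasFDerivAt.comp_hasDerivAt x (f := fun t : ℝ => (t, t)) ((hasDerivAt_id x).prodMk (hasDerivAt_id x))
  refine this.congr_deriv ?_
  simp [Function.HasUncurry.uncurry]

theorem subst_aux (g : ℝ → ℝ → ℝ)
    (hc : ContinuousOn (fun p : ℝ × ℝ => g p.1 p.2) (Icc 0 1 ×ˢ Icc 0 1))
    (t : ℝ) (ht : t ∈ Ioo (0:ℝ) 1) :
    ∫ u in t..1, g u (t / u) * (1 / u) =
      ∫ u in (√t)..1, (g u (t / u) + g (t / u) u) * (1 / u) := by
  obtain ⟨t0, t1⟩ := ht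
  have r0 : 0 < √t := Real.sqrt_pos.2 t0
  have rr : √t * √t = t := Real.mul_self_sqrt t0.le
  have r1 : √t < 1 := by nlinarith
  have tr : t < √t := by nlinarith
  have cd : ContinuousOn (fun u => t / u) (Icc t 1) :=
    continuousOn_const.div continuousOn_id (fun u hu => by have := hu.1; simp; linarith)
  have hm : ∀ u ∈ Icc t 1, u ∈ Icc (0:ℝ) 1 ∧ t / u ∈ Icc (0:ℝ) 1 := by
    intro u hu
    have : 0 < u := by linarith [hu.1]
    exact ⟨⟨this.le, hu.2⟩, by positivity, by rw [div_le_one this]; exact hu.1⟩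
  have c1 : ContinuousOn (fun u => g u (t / u) * (1 / u)) (Icc t 1) := by
    refine ContinuousOn.mul (hc.comp (f := fun u => (u, t / u)) (continuousOn_id.prodMk cd) hm) ?_
    exact continuousOn_const.div continuousOn_id (fun u hu => by have := hu.1; simp; linarith)
  have c2 : ContinuousOn (fun u => g (t / u) u * (1 / u)) (Icc t 1) := by
    refine ContinuousOn.mul (hc.comp (f := fun u => (t / u, u)) (cd.prodMk continuousOn_id)
      (fun u hu => (hm u hu).symm)) ?_
    exact continuousOn_const.div continuousOn_id (fun u hu => by have := hu.1; simp; linarith)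
  have i1 : IntervalIntegrable (fun u => g u (t / u) * (1 / u)) volume t (√t) :=
    (c1.mono (by rw [uIcc_of_le tr.le]; exact Icc_subset_Icc_right r1.le)).intervalIntegrable
  have i2 : IntervalIntegrable (fun u => g u (t / u) * (1 / u)) volume (√t) 1 :=
    (c1.mono (by rw [uIcc_of_le r1.le]; exact Icc_subset_Icc_left tr.le)).intervalIntegrable
  have i3 : IntervalIntegrable (fun u => g (t / u) u * (1 / u)) volume (√t) 1 :=
    (c2.mono (by rw [uIcc_of_le r1.le]; exact Icc_subset_Icc_left tr.le)).intervalIntegrable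
  have S := intervalIntegral.integral_comp_mul_deriv' (a := √t) (b := 1) (f := fun v => t / v)
    (f' := fun v => - t / v ^ 2) (g := fun u => g u (t / u) * (1 / u))
    (by
      intro v hv
      rw [uIcc_of_le r1.le] at hv
      have : v ≠ 0 := by linarith [hv.1]
      have := (hasDerivAt_const v t).div (hasDerivAt_id v) this
      refine this.congr_deriv ?_
      simp)
    (by
      refine continuousOn_const.div (by fun_prop) ?_
      intro v hv
      rw [uIcc_of_le r1.le] at hv
      have : v ≠ 0 := by linarith [hv.1]
      positivity)
    (by
      refine c1.mono ?_
      rintro _ ⟨v, hv, rfl⟩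
      rw [uIcc_of_le r1.le] at hv
      have hv0 : 0 < v := by linarith [hv.1]
      refine ⟨?_, (hm v ⟨by linarith [hv.1], hv.2⟩).2.2⟩
      show t ≤ t / v
      rw [le_div_iff₀ hv0]; nlinarith [hv.2])
  have e1 : t / √t = √t := by rw [div_eq_iff r0.ne']; exact rr.symm
  simp only [div_one, e1] at S
  rw [intervalIntegral.integral_symm t (√t)] at S
  have S2 : ∫ u in (√t)..1, g (t / u) u * (1 / u) =
      - ∫ (x : ℝ) in √t..1, ((fun u => g u (t / u) * (1 / u)) ∘ fun v => t / v) x * (-t / x ^ 2) := by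
    rw [← intervalIntegral.integral_neg]
    refine intervalIntegral.integral_congr ?_
    intro v hv
    rw [uIcc_of_le r1.le] at hv
    have hv0 : v ≠ 0 := by linarith [hv.1]
    have : t / (t / v) = v := by field_simp
    simp only [Function.comp, this]
    field_simp
  rw [S, neg_neg] at S2
  simp only [add_mul]
  rw [intervalIntegral.integral_add i2 i3, S2,
    ← intervalIntegral.integral_add_adjacent_intervals i1 i2]
  ring

theorem step_aux (p p' : ℝ → ℝ → ℝ) (k : ℕ)
    (hd : ∀ x ∈ Icc (0:ℝ) 1, ∀ y ∈ Icc (0:ℝ) 1,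
      HasDerivWithinAt (fun t => p x t) (p' x y) (Icc 0 1) y)
    (cp : ContinuousOn (fun p1 : ℝ × ℝ => p p1.1 p1.2) (Icc 0 1 ×ˢ Icc 0 1))
    (cp' : ContinuousOn (fun p1 : ℝ × ℝ => p' p1.1 p1.2) (Icc 0 1 ×ˢ Icc 0 1))
    (s : ℝ) (hs : s ∈ Ioo (0:ℝ) 1) :
    HasDerivAt (fun t => ∫ u in (√t)..1, p u (t / u) * (1 / u ^ k))
      (-(p (√s) (√s) * (1 / √s ^ k) * (1 / (2 * √s))) +
        ∫ u in (√s)..1, p' u (s / u) * (1 / u ^ (k + 1))) s := by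
  obtain ⟨s0, s1⟩ := hs
  have r0 : 0 < √s := Real.sqrt_pos.2 s0
  have rr : √s * √s = s := Real.mul_self_sqrt s0.le
  have r1 : √s < 1 := by nlinarith
  have tr : s < √s := by nlinarith
  have e1 : s / √s = √s := by rw [div_eq_iff r0.ne']; exact rr.symm
  obtain ⟨c, hc1, hc2⟩ := exists_between tr
  have c0 : 0 < c := s0.trans hc1
  have hm : ∀ t ∈ Icc (0:ℝ) c, ∀ u ∈ Icc c 1, u ∈ Icc (0:ℝ) 1 ∧ t / u ∈ Icc (0:ℝ) 1 := by
    intro t ht u hu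
    have hu0 : 0 < u := by linarith [hu.1]
    exact ⟨⟨hu0.le, hu.2⟩, div_nonneg ht.1 hu0.le, by rw [div_le_one hu0]; linarith [hu.1, ht.2]⟩
  have cc : ∀ (q : ℝ → ℝ → ℝ) (m : ℕ),
      ContinuousOn (fun p1 : ℝ × ℝ => q p1.1 p1.2) (Icc 0 1 ×ˢ Icc 0 1) →
      ContinuousOn (fun z : ℝ × ℝ => q z.2 (z.1 / z.2) * (1 / z.2 ^ m)) (Icc 0 c ×ˢ Icc c 1) := by
    intro q m hq
    have hne : ∀ z ∈ (Icc 0 c ×ˢ Icc c 1 : Set (ℝ × ℝ)), z.2 ≠ 0 := by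
      intro z hz
      have := hz.2.1
      linarith
    refine ContinuousOn.mul (hq.comp (f := fun z : ℝ × ℝ => (z.2, z.1 / z.2))
      (continuousOn_snd.prodMk (continuousOn_fst.div continuousOn_snd hne))
      (fun z hz => hm z.1 hz.1 z.2 hz.2)) ?_
    exact continuousOn_const.div (by fun_prop) (fun z hz => pow_ne_zero _ (hne z hz))
  have L := leib_aux (fun t u => p u (t / u) * (1 / u ^ k))
    (fun t u => p' u (t / u) * (1 / u ^ (k + 1))) 0 c c s (fun t => √t) (1 / (2 * √s))
    ⟨s0, hc1⟩ ⟨hc2, r1⟩ (Real.hasDerivAt_sqrt s0.ne')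
    (by
      intro t ht u hu
      obtain ⟨h1, h2⟩ := hm t (Ioo_subset_Icc_self ht) u hu
      have hu0 : 0 < u := by linarith [hu.1]
      have h3 : HasDerivAt (fun y => p u y) (p' u (t / u)) (t / u) :=
        (hd u h1 _ h2).hasDerivAt (Icc_mem_nhds (div_pos ht.1 hu0)
          (by rw [div_lt_one hu0]; linarith [ht.2, hu.1]))
      have h4 := (h3.comp t ((hasDerivAt_id t).div_const u)).mul_const (1 / u ^ k)
      refine h4.congr_deriv ?_
      field_simp
      ring)
    (cc p k cp) (cc p' (k + 1) cp')
  simpa only [e1] using L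

theorem bound_aux (ε : ℝ) (hε0 : 0 < ε) (hε1 : ε ≤ 1) (H : ℝ) (hH : 0 ≤ H) (q : ℝ → ℝ → ℝ)
    (hq : ∀ x ∈ Icc (0:ℝ) 1, ∀ y ∈ Icc (0:ℝ) 1, |q x y| ≤ 2 * H * (x ^ ε + y ^ ε))
    (r : ℝ) (r0 : 0 < r) (r1 : r < 1) :
    |∫ u in r..1, q u (r ^ 2 / u) * (1 / u ^ 3)| ≤ 8 / 3 * H * r ^ (ε - 2) := by
  have h0 : (0:ℝ) ∉ uIcc r 1 := by
    rw [uIcc_of_le r1.le]; intro h; linarith [h.1]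
  have ii : ∀ e : ℝ, IntervalIntegrable (fun u : ℝ => u ^ e) volume r 1 := fun e =>
    intervalIntegral.intervalIntegrable_rpow (Or.inr h0)
  have B := intervalIntegral.norm_integral_le_of_norm_le (μ := volume) (a := r) (b := 1)
    (f := fun u => q u (r ^ 2 / u) * (1 / u ^ 3))
    (g := fun u => 2 * H * (u ^ (ε - 3) + r ^ (2 * ε) * u ^ (-ε - 3))) r1.le
    (Filter.Eventually.of_forall (by
      intro u hu
      have hu0 : 0 < u := r0.trans hu.1
      have := hq u ⟨hu0.le, hu.2⟩ (r ^ 2 / u) ⟨by positivity, by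
        rw [div_le_one hu0]; nlinarith [hu.1]⟩
      rw [Real.norm_eq_abs, abs_mul, abs_of_pos (a := 1 / u ^ 3) (by positivity)]
      have e1 : u ^ (ε - 3) = u ^ ε * (1 / u ^ 3) := by
        rw [Real.rpow_sub hu0, div_eq_mul_one_div]; norm_cast
      have e2 : u ^ (-ε - 3) = (u ^ ε)⁻¹ * (1 / u ^ 3) := by
        rw [Real.rpow_sub hu0, div_eq_mul_one_div, Real.rpow_neg hu0.le]; norm_cast
      have e3 : (r ^ 2 / u) ^ ε = r ^ (2 * ε) * (u ^ ε)⁻¹ := by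
        rw [Real.div_rpow (by positivity) hu0.le, Real.rpow_mul r0.le, div_eq_mul_inv]; norm_cast
      rw [e3] at this
      rw [e1, e2]
      calc _ ≤ _ := mul_le_mul_of_nonneg_right this (by positivity)
        _ = _ := by ring))
    (((ii _).add ((ii _).const_mul _)).const_mul _)
  rw [Real.norm_eq_abs] at B
  refine B.trans ?_
  rw [intervalIntegral.integral_const_mul, intervalIntegral.integral_add (ii _) ((ii _).const_mul _),
    intervalIntegral.integral_const_mul, integral_rpow (Or.inr ⟨by linarith, h0⟩),
    integral_rpow (Or.inr ⟨by linarith, h0⟩), Real.one_rpow, Real.one_rpow]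
  have x1 : ε - 3 + 1 = ε - 2 := by ring
  have x2 : -ε - 3 + 1 = -ε - 2 := by ring
  rw [x1, x2]
  have e4 : r ^ (2 * ε) * r ^ (-ε - 2) = r ^ (ε - 2) := by
    rw [← Real.rpow_add r0]; congr 1; ring
  have P0 : 0 < r ^ (ε - 2) := by positivity
  have Q0 : 0 < r ^ (2 * ε) := by positivity
  set P := r ^ (ε - 2)
  have y1 : (1 - P) / (ε - 2) ≤ P / (2 - ε) := by
    rw [← neg_div_neg_eq, neg_sub, neg_sub]
    have : 0 < 2 - ε := by linarith
    gcongr; linarith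
  have y2 : r ^ (2 * ε) * ((1 - r ^ (-ε - 2)) / (-ε - 2)) ≤ P / (2 + ε) := by
    have : r ^ (2 * ε) * ((1 - r ^ (-ε - 2)) / (-ε - 2)) = (P - r ^ (2 * ε)) / (2 + ε) := by
      rw [← e4, ← neg_div_neg_eq, neg_sub]
      have : -(-ε - 2) = 2 + ε := by ring
      rw [this]; ring
    rw [this]
    gcongr; linarith
  have y3 : P / (2 - ε) + P / (2 + ε) ≤ 4 / 3 * P := by
    have a1 : 0 < 2 - ε := by linarith
    have a2 : 0 < 2 + ε := by linarith
    rw [div_add_div _ _ a1.ne' a2.ne', div_le_iff₀ (by positivity)]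
    nlinarith [mul_nonneg P0.le (by nlinarith : 0 ≤ 1 - ε ^ 2)]
  nlinarith [mul_le_mul_of_nonneg_left (add_le_add y1 y2) hH, mul_le_mul_of_nonneg_left y3 hH]

/-- Second-derivative bound for `ξ^g` when `g` is `C²` with vanishing 2-jet at the origin
and `ε`-Hölder-type bounds on the second derivatives (proof of Lemma B.1 of the paper). -/
theorem stmt12
    (ε : ℝ) (hε0 : 0 < ε) (hε1 : ε ≤ 1) (H : ℝ) (hH : 0 ≤ H)
    (g g10 g01 g20 g11 g02 : ℝ → ℝ → ℝ)
    (hdiff : ∀ x ∈ Icc (0:ℝ) 1, ∀ y ∈ Icc (0:ℝ) 1,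
      HasDerivWithinAt (fun t => g t y) (g10 x y) (Icc 0 1) x ∧
      HasDerivWithinAt (fun t => g x t) (g01 x y) (Icc 0 1) y ∧
      HasDerivWithinAt (fun t => g10 t y) (g20 x y) (Icc 0 1) x ∧
      HasDerivWithinAt (fun t => g10 x t) (g11 x y) (Icc 0 1) y ∧
      HasDerivWithinAt (fun t => g01 x t) (g02 x y) (Icc 0 1) y)
    (hc : ContinuousOn (fun p : ℝ × ℝ => g p.1 p.2) (Icc 0 1 ×ˢ Icc 0 1))
    (hc10 : ContinuousOn (fun p : ℝ × ℝ => g10 p.1 p.2) (Icc 0 1 ×ˢ Icc 0 1))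
    (hc01 : ContinuousOn (fun p : ℝ × ℝ => g01 p.1 p.2) (Icc 0 1 ×ˢ Icc 0 1))
    (hc20 : ContinuousOn (fun p : ℝ × ℝ => g20 p.1 p.2) (Icc 0 1 ×ˢ Icc 0 1))
    (hc11 : ContinuousOn (fun p : ℝ × ℝ => g11 p.1 p.2) (Icc 0 1 ×ˢ Icc 0 1))
    (hc02 : ContinuousOn (fun p : ℝ × ℝ => g02 p.1 p.2) (Icc 0 1 ×ˢ Icc 0 1))
    (hbd : ∀ x ∈ Icc (0:ℝ) 1, ∀ y ∈ Icc (0:ℝ) 1,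
      |g x y| ≤ H * (x ^ (2 + ε) + y ^ (2 + ε)) ∧
      |g10 x y| ≤ H * (x ^ (1 + ε) + y ^ (1 + ε)) ∧
      |g01 x y| ≤ H * (x ^ (1 + ε) + y ^ (1 + ε)) ∧
      |g20 x y| ≤ H * (x ^ ε + y ^ ε) ∧
      |g02 x y| ≤ H * (x ^ ε + y ^ ε)) :
    (∀ s ∈ Ioo (0:ℝ) 1,
      DifferentiableAt ℝ (fun t => ∫ u in t..1, g u (t / u) * (1 / u)) s) ∧
    ∀ s ∈ Ioo (0:ℝ) 1, ∃ d : ℝ,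
      HasDerivAt (deriv (fun t => ∫ u in t..1, g u (t / u) * (1 / u))) d s ∧
      |d| ≤ 9 * H * s ^ (ε / 2 - 1) := by
  have hswap : ∀ q : ℝ → ℝ → ℝ,
      ContinuousOn (fun p : ℝ × ℝ => q p.1 p.2) (Icc 0 1 ×ˢ Icc 0 1) →
      ContinuousOn (fun p : ℝ × ℝ => q p.2 p.1) (Icc 0 1 ×ˢ Icc 0 1) := fun q h =>
    h.comp (f := fun p : ℝ × ℝ => (p.2, p.1)) (by fun_prop) (fun p hp => ⟨hp.2, hp.1⟩)
  have S1 := step_aux (fun x y => g x y + g y x) (fun x y => g01 x y + g10 y x) 1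
    (fun x hx y hy => (hdiff x hx y hy).2.1.add (hdiff y hy x hx).1)
    (hc.add (hswap _ hc)) (hc01.add (hswap _ hc10))
  have S2 := step_aux (fun x y => g01 x y + g10 y x) (fun x y => g02 x y + g20 y x) 2
    (fun x hx y hy => (hdiff x hx y hy).2.2.2.2.add (hdiff y hy x hx).2.2.1)
    (hc01.add (hswap _ hc10)) (hc02.add (hswap _ hc20))
  have D1 : ∀ s ∈ Ioo (0:ℝ) 1, HasDerivAt (fun t => ∫ u in t..1, g u (t / u) * (1 / u))
      (-(g (√s) (√s) / s) + ∫ u in (√s)..1, (g01 u (s / u) + g10 (s / u) u) * (1 / u ^ 2)) s := by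
    intro s hs
    have r0 : 0 < √s := Real.sqrt_pos.2 hs.1
    have rr : √s * √s = s := Real.mul_self_sqrt hs.1.le
    refine ((S1 s hs).congr_of_eventuallyEq ?_).congr_deriv ?_
    · filter_upwards [isOpen_Ioo.mem_nhds hs] with t ht
      simpa only [pow_one] using subst_aux g hc t ht
    · have : (g √s √s + g √s √s) * (1 / √s ^ 1) * (1 / (2 * √s)) = g (√s) (√s) / s := by
        have h5 : g (√s) (√s) / s = g (√s) (√s) / (√s * √s) := by rw [rr]
        rw [h5]
        field_simp
        ring
      simp only [this, Nat.reduceAdd]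
  refine ⟨fun s hs => (D1 s hs).differentiableAt, fun s hs => ?_⟩
  have r0 : 0 < √s := Real.sqrt_pos.2 hs.1
  have rr : √s * √s = s := Real.mul_self_sqrt hs.1.le
  have r1 : √s < 1 := by nlinarith [hs.2]
  have G := (diag_aux g g10 g01 (fun x hx y hy => ⟨(hdiff x hx y hy).1, (hdiff x hx y hy).2.1⟩)
    hc10 hc01 (√s) ⟨r0, r1⟩).comp s (Real.hasDerivAt_sqrt hs.1.ne')
  have G2 := (G.div (hasDerivAt_id s) hs.1.ne').neg.add (S2 s hs)
  refine ⟨_, G2.congr_of_eventuallyEq ?_, ?_⟩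
  · filter_upwards [isOpen_Ioo.mem_nhds hs] with t ht
    rw [(D1 t ht).deriv]
    rfl
  have hr : √s ∈ Icc (0:ℝ) 1 := ⟨r0.le, r1.le⟩
  obtain ⟨b0, b1, b2, -, -⟩ := hbd _ hr _ hr
  have I := bound_aux ε hε0 hε1 H hH (fun x y => g02 x y + g20 y x)
    (fun x hx y hy => by
      have h1 := (hbd x hx y hy).2.2.2.2
      have h2 := (hbd y hy x hx).2.2.2.1
      refine (abs_add_le _ _).trans ?_
      linarith) (√s) r0 r1
  have hs2 : √s ^ 2 = s := by rw [sq, rr]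
  have hP : s ^ (ε / 2 - 1) = √s ^ (ε - 2) := by
    rw [← hs2, Real.sqrt_sq r0.le, ← Real.rpow_natCast, ← Real.rpow_mul r0.le]
    congr 1; push_cast; ring
  rw [hs2] at I
  have p0 : √s ^ (2 + ε) = √s ^ (ε - 2) * √s ^ 4 := by
    rw [← Real.rpow_natCast, ← Real.rpow_add r0]; congr 1; push_cast; ring
  have p1 : √s ^ (1 + ε) = √s ^ (ε - 2) * √s ^ 3 := by
    rw [← Real.rpow_natCast, ← Real.rpow_add r0]; congr 1; push_cast; ring
  rw [p0] at b0
  rw [p1] at b1 b2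
  rw [hP]
  simp only [Function.comp, id, Nat.reduceAdd]
  generalize (∫ u in (√s)..1, (g02 u (s / u) + g20 (s / u) u) * (1 / u ^ 3)) = J at I ⊢
  generalize g (√s) (√s) = A at b0 ⊢
  generalize g10 (√s) (√s) = B at b1 ⊢
  generalize g01 (√s) (√s) = C at b2 ⊢
  have P0 : 0 < √s ^ (ε - 2) := by positivity
  generalize √s ^ (ε - 2) = P at *
  have key : -(((B + C) * (1 / (2 * √s)) * s - A * 1) / s ^ 2) +
      (-((C + B) * (1 / √s ^ 2) * (1 / (2 * √s))) + J) =
      A / √s ^ 4 - B / √s ^ 3 - C / √s ^ 3 + J := by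
    have : s ^ 2 = √s ^ 4 := by rw [← hs2, Real.sqrt_sq r0.le]; ring
    rw [this]
    have h3 : (B + C) * (1 / (2 * √s)) * s = (B + C) * (1 / (2 * √s)) * √s ^ 2 := by rw [hs2]
    rw [h3]
    field_simp
    ring
  rw [key]
  have k0 : |A / √s ^ 4| ≤ 2 * H * P := by
    rw [abs_div, abs_of_pos (a := √s ^ 4) (by positivity), div_le_iff₀ (by positivity)]; linarith
  have k1 : |B / √s ^ 3| ≤ 2 * H * P := by
    rw [abs_div, abs_of_pos (a := √s ^ 3) (by positivity), div_le_iff₀ (by positivity)]; linarith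
  have k2 : |C / √s ^ 3| ≤ 2 * H * P := by
    rw [abs_div, abs_of_pos (a := √s ^ 3) (by positivity), div_le_iff₀ (by positivity)]; linarith
  have hHP : 0 ≤ H * P := by positivity
  rw [abs_le] at *
  constructor <;> linarith [k0.1, k0.2, k1.1, k1.2, k2.1, k2.2, I.1, I.2]
end

section
/- Let L ≥ 0 and let g : [0,1]×[0,1] → ℝ be Lipschitz continuous with constant L (with respect to the sup-metric on the square) and satisfy g(0,0) = 0. Then for every s ∈ (0,1]: the function u ↦ g(u,0)/u is Lebesgue-integrable on (0,1] and |∫_0^1 g(u,0)·(1/u) du − ∫_{√s}^1 g(u, s/u)·(1/u) du| ≤ L·(2√s − s). -/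
open MeasureTheory Set

/-- The quantitative estimate at the end of the proof of Lemma B.1 of the paper, for `g`
Lipschitz (with respect to the sup-metric on the square) vanishing at the origin. -/
theorem stmt13
    (L : ℝ) (hL : 0 ≤ L)
    (g : ℝ → ℝ → ℝ)
    (hLip : ∀ x ∈ Icc (0:ℝ) 1, ∀ y ∈ Icc (0:ℝ) 1, ∀ x' ∈ Icc (0:ℝ) 1, ∀ y' ∈ Icc (0:ℝ) 1,
      |g x y - g x' y'| ≤ L * max |x - x'| |y - y'|)
    (hg00 : g 0 0 = 0) :
    IntegrableOn (fun u => g u 0 * (1 / u)) (Ioc 0 1) volume ∧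
    ∀ s ∈ Ioc (0:ℝ) 1,
      |(∫ u in (0:ℝ)..1, g u 0 * (1 / u)) -
          ∫ u in Real.sqrt s..1, g u (s / u) * (1 / u)| ≤
        L * (2 * Real.sqrt s - s) := by
  have hLipOn : LipschitzOnWith ⟨L, hL⟩ (fun p : ℝ × ℝ => g p.1 p.2) (Icc 0 1 ×ˢ Icc 0 1) := by
    apply LipschitzOnWith.of_dist_le_mul
    rintro ⟨x, y⟩ ⟨hx, hy⟩ ⟨x', y'⟩ ⟨hx', hy'⟩
    rw [Prod.dist_eq, Real.dist_eq, Real.dist_eq, Real.dist_eq]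
    exact hLip x hx y hy x' hx' y' hy'
  have hc := hLipOn.continuousOn
  have h0 : (0:ℝ) ∈ Icc (0:ℝ) 1 := by simp
  have hc0 : ContinuousOn (fun u => g u 0 * (1 / u)) (Ioc 0 1) := by
    apply ContinuousOn.mul
    · exact hc.comp (f := fun u : ℝ => (u, (0:ℝ))) (by fun_prop)
        (fun u hu => ⟨⟨hu.1.le, hu.2⟩, h0⟩)
    · exact continuousOn_const.div continuousOn_id (fun u hu => hu.1.ne')
  have hb : ∀ u ∈ Ioc (0:ℝ) 1, ‖g u 0 * (1 / u)‖ ≤ L := by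
    intro u hu
    have h1 := hLip u ⟨hu.1.le, hu.2⟩ 0 h0 0 h0 0 h0
    rw [hg00] at h1
    simp only [sub_zero, abs_zero, abs_of_pos hu.1, max_eq_left hu.1.le] at h1
    rw [Real.norm_eq_abs, abs_mul, abs_of_pos (one_div_pos.mpr hu.1), mul_one_div,
      div_le_iff₀ hu.1]
    exact h1
  have hint : IntegrableOn (fun u => g u 0 * (1 / u)) (Ioc 0 1) volume :=
    IntegrableOn.of_bound (C := L) (by simp)
      (hc0.aestronglyMeasurable measurableSet_Ioc)
      ((ae_restrict_iff' measurableSet_Ioc).mpr (Filter.Eventually.of_forall hb))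
  refine ⟨hint, ?_⟩
  intro s hs
  set r := Real.sqrt s with hr
  have hr0 : 0 < r := Real.sqrt_pos.mpr hs.1
  have hr1 : r ≤ 1 := Real.sqrt_le_one.mpr hs.2
  have hrr : r * r = s := Real.mul_self_sqrt hs.1.le
  have hI1 : IntervalIntegrable (fun u => g u 0 * (1 / u)) volume 0 r :=
    (intervalIntegrable_iff_integrableOn_Ioc_of_le hr0.le).mpr
      (hint.mono_set (Ioc_subset_Ioc_right hr1))
  have hI2 : IntervalIntegrable (fun u => g u 0 * (1 / u)) volume r 1 :=
    (intervalIntegrable_iff_integrableOn_Ioc_of_le hr1).mpr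
      (hint.mono_set (Ioc_subset_Ioc_left hr0.le))
  have hsu : ∀ u ∈ Icc r 1, s / u ∈ Icc (0:ℝ) 1 := by
    intro u hu
    have hu0 : 0 < u := hr0.trans_le hu.1
    refine ⟨(div_pos hs.1 hu0).le, ?_⟩
    rw [div_le_one hu0]
    nlinarith [hu.1]
  have hne : ∀ u ∈ Icc r 1, u ≠ 0 := fun u hu => (hr0.trans_le hu.1).ne'
  have hI3 : IntervalIntegrable (fun u => g u (s / u) * (1 / u)) volume r 1 := by
    apply ContinuousOn.intervalIntegrable
    rw [uIcc_of_le hr1]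
    apply ContinuousOn.mul
    · exact hc.comp (f := fun u : ℝ => (u, s / u))
        (continuousOn_id.prodMk (continuousOn_const.div continuousOn_id hne))
        (fun u hu => ⟨⟨hr0.le.trans hu.1, hu.2⟩, hsu u hu⟩)
    · exact continuousOn_const.div continuousOn_id hne
  have hA : ‖∫ u in (0:ℝ)..r, g u 0 * (1 / u)‖ ≤ L * |r - 0| := by
    apply intervalIntegral.norm_integral_le_of_norm_le_const
    intro u hu
    rw [uIoc_of_le hr0.le] at hu
    exact hb u ⟨hu.1, hu.2.trans hr1⟩
  have hI4 : IntervalIntegrable (fun u : ℝ => L * s / u ^ 2) volume r 1 := by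
    apply ContinuousOn.intervalIntegrable
    rw [uIcc_of_le hr1]
    exact continuousOn_const.div (by fun_prop) (fun u hu => pow_ne_zero 2 (hne u hu))
  have hval : ∫ u in r..1, L * s / u ^ 2 = L * (r - s) := by
    have := intervalIntegral.integral_eq_sub_of_hasDerivAt (a := r) (b := 1)
      (f := fun u : ℝ => -(L * s) * u⁻¹) (f' := fun u : ℝ => L * s / u ^ 2) (by
        intro u hu
        rw [uIcc_of_le hr1] at hu
        have := (hasDerivAt_inv (hne u hu)).const_mul (-(L * s))
        refine this.congr_deriv ?_
        rw [neg_mul_neg, div_eq_mul_inv]) hI4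
    rw [this, ← hrr]
    field_simp
    ring
  have hB : ‖∫ u in r..1, (g u 0 * (1 / u) - g u (s / u) * (1 / u))‖ ≤ L * (r - s) := by
    rw [← hval]
    apply intervalIntegral.norm_integral_le_of_norm_le hr1 _ hI4
    refine Filter.Eventually.of_forall fun u hu => ?_
    have hu' : u ∈ Icc r 1 := ⟨hu.1.le, hu.2⟩
    have hu0 : 0 < u := hr0.trans hu.1
    have huI : u ∈ Icc (0:ℝ) 1 := ⟨hu0.le, hu.2⟩
    have h1 := hLip u huI 0 h0 u huI (s / u) (hsu u hu')
    have h2 : 0 < s / u := div_pos hs.1 hu0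
    rw [sub_self, abs_zero, zero_sub, abs_neg, abs_of_pos h2, max_eq_right h2.le] at h1
    rw [← sub_mul, Real.norm_eq_abs, abs_mul, abs_of_pos (one_div_pos.mpr hu0)]
    calc _ ≤ L * (s / u) * (1 / u) := by gcongr
      _ = _ := by field_simp
  rw [intervalIntegral.integral_sub hI2 hI3] at hB
  rw [← intervalIntegral.integral_add_adjacent_intervals hI1 hI2, add_sub_assoc]
  rw [Real.norm_eq_abs] at hA hB
  rw [sub_zero, abs_of_pos hr0] at hA
  refine (abs_add_le _ _).trans ?_
  linarith
end

section
/- Let a < b be real numbers, m > 0, V ≥ 0, and let ψ : [a,b] → ℝ be twice continuously differentiable with |ψ′(x)| ≥ m for all x ∈ [a,b] and ∫_a^b |ψ″(x)| dx ≤ V. Then for every real s ≠ 0: |∫_a^b e^{i s ψ(x)} dx| ≤ (1/|s|)·(2/m + V/m²). -/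
open MeasureTheory Set

/-- The first-derivative oscillatory-integral (van der Corput type) estimate from the
proof of Proposition 5.9 of the paper. -/
theorem stmt14
    (a b : ℝ) (hab : a < b) (m V : ℝ) (hm : 0 < m) (hV : 0 ≤ V)
    (ψ ψ' ψ'' : ℝ → ℝ)
    (hψ : ∀ x ∈ Icc a b, HasDerivWithinAt ψ (ψ' x) (Icc a b) x)
    (hψ' : ∀ x ∈ Icc a b, HasDerivWithinAt ψ' (ψ'' x) (Icc a b) x)
    (hcont : ContinuousOn ψ'' (Icc a b))
    (hlow : ∀ x ∈ Icc a b, m ≤ |ψ' x|)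
    (hvar : (∫ x in a..b, |ψ'' x|) ≤ V) :
    ∀ s : ℝ, s ≠ 0 →
      ‖∫ x in a..b, Complex.exp (Complex.I * ((s * ψ x : ℝ) : ℂ))‖ ≤
        (1 / |s|) * (2 / m + V / m ^ 2) := by
  intro s hs
  have hne : ∀ x ∈ Icc a b, ψ' x ≠ 0 := fun x hx h => by
    have := hlow x hx
    rw [h, abs_zero] at this
    linarith
  have hsC : (s : ℂ) ≠ 0 := by exact_mod_cast hs
  have hs0 : 0 < |s| := abs_pos.mpr hs
  have hneC : ∀ x ∈ Icc a b, (ψ' x : ℂ) ≠ 0 := fun x hx => by exact_mod_cast hne x hx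
  set E : ℝ → ℂ := fun x => Complex.exp (Complex.I * ((s * ψ x : ℝ) : ℂ)) with hE
  have hEn : ∀ x, ‖E x‖ = 1 := fun x => by
    simp only [hE]
    rw [mul_comm]
    exact Complex.norm_exp_ofReal_mul_I _
  have hcψ : ContinuousOn ψ (Icc a b) := fun x hx => (hψ x hx).continuousWithinAt
  have hcψ' : ContinuousOn ψ' (Icc a b) := fun x hx => (hψ' x hx).continuousWithinAt
  have hcE : ContinuousOn E (Icc a b) :=
    Complex.continuous_exp.comp_continuousOn (continuousOn_const.mul
      (Complex.continuous_ofReal.comp_continuousOn (continuousOn_const.mul hcψ)))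
  have hcP : ContinuousOn (fun x => (ψ' x : ℂ)) (Icc a b) :=
    Complex.continuous_ofReal.comp_continuousOn hcψ'
  have hcQ : ContinuousOn (fun x => (ψ'' x : ℂ)) (Icc a b) :=
    Complex.continuous_ofReal.comp_continuousOn hcont
  set F : ℝ → ℂ := fun x => E x / (Complex.I * s * ψ' x) with hF
  set G : ℝ → ℂ := fun x => E x * ψ'' x / (Complex.I * s * (ψ' x) ^ 2) with hG
  have hcF : ContinuousOn F (Icc a b) :=
    hcE.div (continuousOn_const.mul hcP) (fun x hx =>
      mul_ne_zero (mul_ne_zero Complex.I_ne_zero hsC) (hneC x hx))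
  have hcG : ContinuousOn G (Icc a b) :=
    (hcE.mul hcQ).div (continuousOn_const.mul (hcP.pow 2)) (fun x hx =>
      mul_ne_zero (mul_ne_zero Complex.I_ne_zero hsC) (pow_ne_zero 2 (hneC x hx)))
  have iE : IntervalIntegrable E volume a b := hcE.intervalIntegrable_of_Icc hab.le
  have iG : IntervalIntegrable G volume a b := hcG.intervalIntegrable_of_Icc hab.le
  have hd : ∀ x ∈ Ioo a b, HasDerivAt F (E x - G x) x := by
    intro x hx
    have hx' := Ioo_subset_Icc_self hx
    have hn := Icc_mem_nhds hx.1 hx.2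
    have h1 := ((((hψ x hx').hasDerivAt hn).const_mul s).ofReal_comp.const_mul Complex.I).cexp
    have h2 := ((hψ' x hx').hasDerivAt hn).ofReal_comp.const_mul (Complex.I * s)
    have hp := hneC x hx'
    have h3 := h1.div h2 (mul_ne_zero (mul_ne_zero Complex.I_ne_zero hsC) hp)
    refine h3.congr_deriv ?_
    simp only [hG, hE]
    have hI := Complex.I_ne_zero
    push_cast
    field_simp
  have hint := intervalIntegral.integral_eq_sub_of_hasDerivAt_of_le hab.le hcF hd (iE.sub iG)
  rw [intervalIntegral.integral_sub iE iG] at hint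
  have hint' : ∫ x in a..b, E x = F b - F a + ∫ x in a..b, G x := by
    rw [← hint]; ring
  have hFn : ∀ x ∈ Icc a b, ‖F x‖ ≤ 1 / (|s| * m) := by
    intro x hx
    simp only [hF, norm_div, norm_mul, hEn, Complex.norm_I, Complex.norm_real, Real.norm_eq_abs,
      one_mul]
    have := hlow x hx
    gcongr
  have hGn : ‖∫ x in a..b, G x‖ ≤ ∫ x in a..b, (1 / (|s| * m ^ 2)) * |ψ'' x| := by
    refine intervalIntegral.norm_integral_le_of_norm_le hab.le ?_ ?_
    · refine Filter.Eventually.of_forall fun x hx => ?_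
      have := hlow x (Ioc_subset_Icc_self hx)
      simp only [hG, norm_div, norm_mul, norm_pow, hEn, Complex.norm_I, Complex.norm_real,
        Real.norm_eq_abs, one_mul]
      rw [div_mul_eq_mul_div, one_mul]
      gcongr
    · exact (continuousOn_const.mul hcont.abs).intervalIntegrable_of_Icc hab.le
  rw [intervalIntegral.integral_const_mul] at hGn
  have hV' : (1 / (|s| * m ^ 2)) * (∫ x in a..b, |ψ'' x|) ≤ (1 / (|s| * m ^ 2)) * V := by
    gcongr
  rw [hint']
  have hb := hFn b (right_mem_Icc.mpr hab.le)
  have ha := hFn a (left_mem_Icc.mpr hab.le)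
  have e : (1 / |s|) * (2 / m + V / m ^ 2)
      = 1 / (|s| * m) + 1 / (|s| * m) + (1 / (|s| * m ^ 2)) * V := by
    field_simp
    ring
  rw [e]
  have t1 := norm_add_le (F b - F a) (∫ x in a..b, G x)
  have t2 := norm_sub_le (F b) (F a)
  linarith
end

section
/- Let p < q be real numbers and D > 0. Let F : [p,q] → ℝ be differentiable with differentiable derivative F′, and suppose |F″(x)| ≥ D for all x ∈ [p,q]. Then there exists a closed subinterval J ⊆ [p,q] of length (q−p)/3 such that |F′(x)| ≥ D·(q−p)/6 for all x ∈ J. -/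
open Set

theorem aux_pos (p q : ℝ) (hpq : p < q) (D : ℝ) (hD : 0 < D) (g g' : ℝ → ℝ)
    (hg : ∀ x ∈ Icc p q, HasDerivWithinAt g (g' x) (Icc p q) x)
    (hlow : ∀ x ∈ Icc p q, D ≤ g' x) :
    ∃ u v : ℝ, p ≤ u ∧ v ≤ q ∧ v - u = (q - p) / 3 ∧
      ∀ x ∈ Icc u v, D * (q - p) / 6 ≤ |g x| := by
  have key : ∀ x y, p ≤ x → x < y → y ≤ q → D * (y - x) ≤ g y - g x := by
    intro x y hx hxy hy
    have hsub : Icc x y ⊆ Icc p q := Icc_subset_Icc hx hy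
    obtain ⟨c, hc, h⟩ := exists_hasDerivAt_eq_slope g g' hxy
      (fun z hz => ((hg z (hsub hz)).mono hsub).continuousWithinAt)
      (fun z hz => (hg z (hsub (Ioo_subset_Icc_self hz))).hasDerivAt
        (Icc_mem_nhds (hx.trans_lt hz.1) (hz.2.trans_le hy)))
    have h2 := hlow c (hsub (Ioo_subset_Icc_self hc))
    rw [h, le_div_iff₀ (by linarith)] at h2
    exact h2
  rcases le_total 0 (g ((p + q) / 2)) with h | h
  · refine ⟨q - (q - p) / 3, q, by linarith, le_rfl, by ring, fun x hx => ?_⟩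
    have h1 := key ((p + q) / 2) x (by linarith) (by linarith [hx.1]) hx.2
    refine le_trans ?_ (le_abs_self _)
    nlinarith [mul_le_mul_of_nonneg_left hx.1 hD.le]
  · refine ⟨p, p + (q - p) / 3, le_rfl, by linarith, by ring, fun x hx => ?_⟩
    have h1 := key x ((p + q) / 2) hx.1 (by linarith [hx.2]) (by linarith)
    refine le_trans ?_ (neg_le_abs _)
    nlinarith [mul_le_mul_of_nonneg_left hx.2 hD.le]

/-- The derivative-localization lemma from the proof of Corollary 5.7 of the paper. -/
theorem stmt15
    (p q : ℝ) (hpq : p < q) (D : ℝ) (hD : 0 < D)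
    (F F' F'' : ℝ → ℝ)
    (hF : ∀ x ∈ Icc p q, HasDerivWithinAt F (F' x) (Icc p q) x)
    (hF' : ∀ x ∈ Icc p q, HasDerivWithinAt F' (F'' x) (Icc p q) x)
    (hlow : ∀ x ∈ Icc p q, D ≤ |F'' x|) :
    ∃ u v : ℝ, p ≤ u ∧ v ≤ q ∧ v - u = (q - p) / 3 ∧
      ∀ x ∈ Icc u v, D * (q - p) / 6 ≤ |F' x| := by
  rcases hasDerivWithinAt_forall_lt_or_forall_gt_of_forall_ne (convex_Icc p q) hF' (m := 0)
    (fun x hx h0 => by have := hlow x hx; rw [h0, abs_zero] at this; linarith) with h | h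
  · have := aux_pos p q hpq D hD (fun x => -F' x) (fun x => -F'' x)
      (fun x hx => (hF' x hx).neg)
      (fun x hx => by have := hlow x hx; rwa [abs_of_neg (h x hx)] at this)
    simpa only [abs_neg] using this
  · exact aux_pos p q hpq D hD F' F'' hF'
      (fun x hx => by have := hlow x hx; rwa [abs_of_pos (h x hx)] at this)
end

section
/- Let λ > 0, let p be a real number, let q be a positive integer, and let x₁, …, x_q be real numbers such that |x_i − x_j| ≥ λ for all i ≠ j and |x_j − p| ≥ λ/2 for all j. Then Σ_{j=1}^q 1/(x_j − p)² ≤ π²/λ². -/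
open Finset

theorem aux_odd : HasSum (fun n : ℕ => 1 / ((n : ℝ) + 1 / 2) ^ 2) (Real.pi ^ 2 / 2) := by
  have h := hasSum_zeta_two
  have he : HasSum (fun k : ℕ => (1 : ℝ) / ((2 * k : ℕ) : ℝ) ^ 2) (Real.pi ^ 2 / 6 * (1 / 4)) := by
    have := h.mul_right (1 / 4)
    refine this.congr_fun ?_
    intro k
    push_cast
    rw [mul_pow, one_div_mul_one_div]
    ring_nf
  have ho : Summable (fun k : ℕ => (1 : ℝ) / ((2 * k + 1 : ℕ) : ℝ) ^ 2) :=
    h.summable.comp_injective (i := fun k : ℕ => 2 * k + 1) (fun a b hab => by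
      simp only at hab; omega)
  have hs := (he.even_add_odd (f := fun n : ℕ => (1 : ℝ) / (n : ℝ) ^ 2) ho.hasSum).unique h
  have h2 := ho.hasSum.mul_right 4
  have e : (∑' k : ℕ, (1 : ℝ) / ((2 * k + 1 : ℕ) : ℝ) ^ 2) * 4 = Real.pi ^ 2 / 2 := by linarith
  rw [e] at h2
  refine h2.congr_fun ?_
  intro n
  push_cast
  have : (n : ℝ) + 1 / 2 ≠ 0 := by positivity
  have : (2 * n : ℝ) + 1 ≠ 0 := by positivity
  field_simp
  ring

theorem aux_side {ι : Type*} (s : Finset ι) (y : ι → ℝ)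
    (hsep : ∀ i ∈ s, ∀ j ∈ s, i ≠ j → 1 ≤ |y i - y j|) (hy : ∀ i ∈ s, 1 / 2 ≤ y i) :
    ∑ j ∈ s, 1 / (y j) ^ 2 ≤ Real.pi ^ 2 / 2 := by
  classical
  have hinj : Set.InjOn (fun j => ⌊y j - 1 / 2⌋₊) s := by
    intro i hi j hj hij
    by_contra hne
    have h1 := hsep i hi j hj hne
    simp only at hij
    have a1 := Nat.floor_le (sub_nonneg.2 (hy i hi))
    have a2 := Nat.lt_floor_add_one (y i - 1 / 2)
    have b1 := Nat.floor_le (sub_nonneg.2 (hy j hj))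
    have b2 := Nat.lt_floor_add_one (y j - 1 / 2)
    rw [hij] at a1 a2
    have : |y i - y j| < 1 := abs_lt.2 ⟨by linarith, by linarith⟩
    linarith
  calc ∑ j ∈ s, 1 / (y j) ^ 2
      ≤ ∑ j ∈ s, 1 / ((⌊y j - 1 / 2⌋₊ : ℝ) + 1 / 2) ^ 2 := by
        refine Finset.sum_le_sum fun j hj => ?_
        have b1 := Nat.floor_le (sub_nonneg.2 (hy j hj))
        apply one_div_le_one_div_of_le (by positivity)
        apply pow_le_pow_left₀ (by positivity)
        linarith
    _ = ∑ n ∈ s.image (fun j => ⌊y j - 1 / 2⌋₊), 1 / ((n : ℝ) + 1 / 2) ^ 2 :=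
        (Finset.sum_image (f := fun n : ℕ => 1 / ((n : ℝ) + 1 / 2) ^ 2) hinj).symm
    _ ≤ Real.pi ^ 2 / 2 := sum_le_hasSum _ (fun n _ => by positivity) aux_odd

/-- The spacing estimate for sums of inverse squares over a separated set of points,
used in the proof of Lemma 5.6 of the paper. -/
theorem stmt16
    (lam : ℝ) (hlam : 0 < lam) (p : ℝ) (q : ℕ) (hq : 0 < q)
    (x : Fin q → ℝ)
    (hsep : ∀ i j : Fin q, i ≠ j → lam ≤ |x i - x j|)
    (hp : ∀ j : Fin q, lam / 2 ≤ |x j - p|) :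
    ∑ j : Fin q, 1 / (x j - p) ^ 2 ≤ Real.pi ^ 2 / lam ^ 2 := by
  have key : ∑ j : Fin q, 1 / ((x j - p) / lam) ^ 2 ≤ Real.pi ^ 2 := by
    rw [← Finset.sum_filter_add_sum_filter_not univ (fun j => 0 ≤ x j - p)]
    have h1 := aux_side (univ.filter (fun j => 0 ≤ x j - p)) (fun j => (x j - p) / lam)
      (by
        intro i _ j _ hij
        have : (x i - p) / lam - (x j - p) / lam = (x i - x j) / lam := by ring
        rw [this, abs_div, abs_of_pos hlam, one_le_div hlam]
        exact hsep i j hij)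
      (by
        intro i hi
        have hi := (Finset.mem_filter.1 hi).2
        have h := hp i
        rw [abs_of_nonneg hi] at h
        rw [le_div_iff₀ hlam]; linarith)
    have h2 := aux_side (univ.filter (fun j => ¬ 0 ≤ x j - p)) (fun j => -((x j - p) / lam))
      (by
        intro i _ j _ hij
        have : -((x i - p) / lam) - -((x j - p) / lam) = -((x i - x j) / lam) := by ring
        rw [this, abs_neg, abs_div, abs_of_pos hlam, one_le_div hlam]
        exact hsep i j hij)
      (by
        intro i hi
        have hi := (Finset.mem_filter.1 hi).2
        have h := hp i
        rw [abs_of_neg (not_le.1 hi)] at h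
        rw [← neg_div, le_div_iff₀ hlam]; linarith)
    simp only [neg_sq] at h2
    linarith
  rw [le_div_iff₀ (by positivity), Finset.sum_mul]
  refine le_of_eq_of_le (Finset.sum_congr rfl fun j _ => ?_) key
  rw [div_pow, one_div_div]
  ring
end

section
/- Let (X,d) be a compact metric space, μ a Borel probability measure on X, and T : X → X a Borel measurable measure-preserving transformation. Let (q_n) be a sequence of natural numbers, (Ξ_n) Borel subsets of X and δ ≥ 0 such that μ(Ξ_n) → δ and sup_{x∈Ξ_n} d(x, T^{q_n} x) → 0. Then for every Borel measurable h : X → ℝ and every real s: ∫_{Ξ_n} e^{2πi s (h(T^{q_n} x) − h(x))} dμ(x) → δ as n → ∞. -/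
open MeasureTheory Set Filter

/-- The core of the proof of Corollary 5.10 of the paper: along rigidity times, the
integrals over the rigidity sets of the exponentials of a measurable-coboundary cocycle
converge to `δ`. -/
theorem stmt17
    {X : Type*} [MetricSpace X] [CompactSpace X] [MeasurableSpace X] [BorelSpace X]
    (μ : Measure X) [IsProbabilityMeasure μ]
    (T : X → X) (hTmeas : Measurable T) (hTpres : MeasurePreserving T μ μ)
    (q : ℕ → ℕ) (Ξ : ℕ → Set X) (hΞ : ∀ n, MeasurableSet (Ξ n))
    (δ : ℝ) (hδ : 0 ≤ δ)
    (hμΞ : Tendsto (fun n => (μ (Ξ n)).toReal) atTop (nhds δ))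
    (hd : Tendsto (fun n => ⨆ x ∈ Ξ n, dist x (T^[q n] x)) atTop (nhds 0))
    (h : X → ℝ) (hh : Measurable h) (s : ℝ) :
    Tendsto (fun n => ∫ x in Ξ n,
        Complex.exp (2 * (Real.pi : ℂ) * Complex.I *
          ((s * (h (T^[q n] x) - h x) : ℝ) : ℂ)) ∂μ)
      atTop (nhds (δ : ℂ)) := by
  have key : ∀ ε > 0, ∀ᶠ n in atTop, ‖(∫ x in Ξ n,
        Complex.exp (2 * (Real.pi : ℂ) * Complex.I *
          ((s * (h (T^[q n] x) - h x) : ℝ) : ℂ)) ∂μ) - (((μ (Ξ n)).toReal : ℝ) : ℂ)‖ ≤ 3 * ε := by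
    intro ε hε
    let u : X → ℂ := fun x => Complex.exp (((2 * Real.pi * (s * h x) : ℝ) : ℂ) * Complex.I)
    have hu1 : ∀ x, ‖u x‖ = 1 := fun x => Complex.norm_exp_ofReal_mul_I _
    have hum : Measurable u := by
      show Measurable fun x => Complex.exp (((2 * Real.pi * (s * h x) : ℝ) : ℂ) * Complex.I)
      fun_prop
    have hui : Integrable u μ :=
      Integrable.of_bound hum.aestronglyMeasurable 1 (Eventually.of_forall fun x => (hu1 x).le)
    obtain ⟨g, hg, hgi⟩ := hui.exists_boundedContinuous_integral_sub_le hε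
    have hgu : UniformContinuous g := CompactSpace.uniformContinuous_of_continuous g.continuous
    obtain ⟨η, hη, hgη⟩ := Metric.uniformContinuous_iff.1 hgu ε hε
    filter_upwards [hd.eventually (gt_mem_nhds hη)] with n hn
    have hS : MeasurePreserving (T^[q n]) μ μ := hTpres.iterate (q n)
    have hdist : ∀ x ∈ Ξ n, dist x (T^[q n] x) < η := by
      intro x hx
      refine lt_of_le_of_lt ?_ hn
      have hb : BddAbove (range fun x => ⨆ _ : x ∈ Ξ n, dist x (T^[q n] x)) := by
        refine ⟨Metric.diam (univ : Set X), ?_⟩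
        rintro _ ⟨y, rfl⟩
        refine Real.iSup_le (fun _ => ?_) Metric.diam_nonneg
        exact Metric.dist_le_diam_of_mem isCompact_univ.isBounded (mem_univ _) (mem_univ _)
      have h2 := le_ciSup hb x
      simpa [hx] using h2
    have hdi : Integrable (fun x => ‖u x - g x‖) μ := (hui.sub hgi).norm
    have hdiS : Integrable (fun x => ‖u (T^[q n] x) - g (T^[q n] x)‖) μ :=
      hS.integrable_comp_of_integrable hdi
    have hSint : ∫ x, ‖u (T^[q n] x) - g (T^[q n] x)‖ ∂μ = ∫ x, ‖u x - g x‖ ∂μ := by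
      have h3 := integral_map (μ := μ) hS.measurable.aemeasurable
        (f := fun x => ‖u x - g x‖) (by rw [hS.map_eq]; exact hdi.aestronglyMeasurable)
      rw [hS.map_eq] at h3
      exact h3.symm
    have hSm : Measurable (T^[q n]) := hS.measurable
    have hFm : Measurable fun x => Complex.exp (2 * (Real.pi : ℂ) * Complex.I *
          ((s * (h (T^[q n] x) - h x) : ℝ) : ℂ)) := by
      have : Measurable fun x => h (T^[q n] x) := hh.comp hSm
      fun_prop
    have hFeq : ∀ x, Complex.exp (2 * (Real.pi : ℂ) * Complex.I *
          ((s * (h (T^[q n] x) - h x) : ℝ) : ℂ)) = u (T^[q n] x) / u x := by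
      intro x
      simp only [u]
      rw [← Complex.exp_sub]
      congr 1
      push_cast
      ring
    have hFi : Integrable (fun x => Complex.exp (2 * (Real.pi : ℂ) * Complex.I *
          ((s * (h (T^[q n] x) - h x) : ℝ) : ℂ))) μ := by
      refine Integrable.of_bound hFm.aestronglyMeasurable 1 (Eventually.of_forall fun x => ?_)
      rw [hFeq, norm_div, hu1, hu1]; norm_num
    have hone : (((μ (Ξ n)).toReal : ℝ) : ℂ) = ∫ x in Ξ n, (1 : ℂ) ∂μ := by
      simp [Measure.real]
    rw [hone, ← integral_sub hFi.integrableOn (integrable_const _)]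
    have hGi : Integrable (fun x => ‖u (T^[q n] x) - g (T^[q n] x)‖ + ‖u x - g x‖ + ε) μ :=
      (hdiS.add hdi).add (integrable_const _)
    calc _ ≤ ∫ x in Ξ n, (‖u (T^[q n] x) - g (T^[q n] x)‖ + ‖u x - g x‖ + ε) ∂μ := by
          refine norm_integral_le_of_norm_le hGi.integrableOn ?_
          refine (ae_restrict_iff' (hΞ n)).2 (Eventually.of_forall fun x hx => ?_)
          have hne : u x ≠ 0 := Complex.exp_ne_zero _
          rw [hFeq, div_sub_one hne, norm_div, hu1, div_one]
          have h4 : ‖g (T^[q n] x) - g x‖ < ε := by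
            rw [← dist_eq_norm, dist_comm]; exact hgη (hdist x hx)
          have h5 : u (T^[q n] x) - u x = (u (T^[q n] x) - g (T^[q n] x)) - (u x - g x)
            + (g (T^[q n] x) - g x) := by ring
          rw [h5]
          have h6 := norm_add_le ((u (T^[q n] x) - g (T^[q n] x)) - (u x - g x))
            (g (T^[q n] x) - g x)
          have h7 := norm_sub_le (u (T^[q n] x) - g (T^[q n] x)) (u x - g x)
          linarith
      _ ≤ ∫ x, (‖u (T^[q n] x) - g (T^[q n] x)‖ + ‖u x - g x‖ + ε) ∂μ :=
          setIntegral_le_integral hGi (Eventually.of_forall fun x => by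
            show (0 : ℝ) ≤ _
            positivity)
      _ = (∫ x, ‖u x - g x‖ ∂μ) + (∫ x, ‖u x - g x‖ ∂μ) + ε := by
          have h8 : Integrable (fun x => ‖u (T^[q n] x) - g (T^[q n] x)‖ + ‖u x - g x‖) μ :=
            hdiS.add hdi
          rw [integral_add h8 (integrable_const _), integral_add hdiS hdi, hSint]
          simp
      _ ≤ 3 * ε := by linarith
  have hc : Tendsto (fun n => (((μ (Ξ n)).toReal : ℝ) : ℂ)) atTop (nhds (δ : ℂ)) :=
    (Complex.continuous_ofReal.tendsto δ).comp hμΞ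
  have h0 : Tendsto (fun n => (∫ x in Ξ n,
        Complex.exp (2 * (Real.pi : ℂ) * Complex.I *
          ((s * (h (T^[q n] x) - h x) : ℝ) : ℂ)) ∂μ) - (((μ (Ξ n)).toReal : ℝ) : ℂ))
      atTop (nhds 0) := by
    rw [Metric.tendsto_nhds]
    intro ε hε
    filter_upwards [key (ε / 4) (by positivity)] with n hn
    rw [dist_zero_right]
    linarith
  simpa using h0.add hc
end

section
/- Let V : ℝ² → ℝ be continuous with V(x,y) > 0 for all (x,y), let T > 0, and let x, y : [0,T] → ℝ be differentiable functions satisfying x′(t) = V(x(t),y(t))·x(t) and y′(t) = −V(x(t),y(t))·y(t) for all t ∈ [0,T]. Assume x(0) > 0 and s := x(0)·y(0) ≠ 0. Then: (i) x(t)·y(t) = s for all t ∈ [0,T]; (ii) x(t) > 0 for all t and x is strictly increasing on [0,T]; and (iii) for every continuous f : ℝ² → ℝ, ∫_0^T f(x(t), y(t)) dt = ∫_{x(0)}^{x(T)} f(u, s/u) / (V(u, s/u)·u) du. -/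
open MeasureTheory Set

/-- The first-integral and time-change computation in singular adapted coordinates from
the proof of Theorem B.2 (Theorem 6.3) of the paper. -/
theorem stmt19
    (V : ℝ × ℝ → ℝ) (hVc : Continuous V) (hVpos : ∀ p : ℝ × ℝ, 0 < V p)
    (T : ℝ) (hT : 0 < T) (x y : ℝ → ℝ)
    (hx : ∀ t ∈ Icc (0:ℝ) T, HasDerivWithinAt x (V (x t, y t) * x t) (Icc 0 T) t)
    (hy : ∀ t ∈ Icc (0:ℝ) T, HasDerivWithinAt y (-(V (x t, y t) * y t)) (Icc 0 T) t)
    (hx0 : 0 < x 0) (hs : x 0 * y 0 ≠ 0) :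
    (∀ t ∈ Icc (0:ℝ) T, x t * y t = x 0 * y 0) ∧
    (∀ t ∈ Icc (0:ℝ) T, 0 < x t) ∧
    StrictMonoOn x (Icc 0 T) ∧
    ∀ f : ℝ × ℝ → ℝ, Continuous f →
      (∫ t in (0:ℝ)..T, f (x t, y t)) =
        ∫ u in (x 0)..(x T),
          f (u, (x 0 * y 0) / u) / (V (u, (x 0 * y 0) / u) * u) := by
  have hxc : ContinuousOn x (Icc 0 T) := fun t ht => (hx t ht).continuousWithinAt
  have hyc : ContinuousOn y (Icc 0 T) := fun t ht => (hy t ht).continuousWithinAt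
  have h1 : ∀ t ∈ Icc (0:ℝ) T, x t * y t = x 0 * y 0 := by
    refine constant_of_has_deriv_right_zero (f := fun t => x t * y t) (hxc.mul hyc) ?_
    intro t ht
    have ht' : t ∈ Icc (0:ℝ) T := ⟨ht.1, ht.2.le⟩
    have h := (hx t ht').mul (hy t ht')
    have h2 : HasDerivWithinAt (fun t => x t * y t) 0 (Icc 0 T) t := by
      refine h.congr_deriv ?_
      ring
    exact h2.mono_of_mem_nhdsWithin (Icc_mem_nhdsGE_of_mem ht)
  have h2 : ∀ t ∈ Icc (0:ℝ) T, 0 < x t := by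
    intro t ht
    by_contra hn
    push Not at hn
    obtain ⟨r, hr, hr0⟩ := intermediate_value_Icc' ht.1
      (hxc.mono (Icc_subset_Icc_right ht.2)) (show (0:ℝ) ∈ Icc (x t) (x 0) from ⟨hn, hx0.le⟩)
    have := h1 r ⟨hr.1, hr.2.trans ht.2⟩
    rw [hr0, zero_mul] at this
    exact hs this.symm
  have hda : ∀ t ∈ Ioo (0:ℝ) T, HasDerivAt x (V (x t, y t) * x t) t := fun t ht =>
    (hx t (Ioo_subset_Icc_self ht)).hasDerivAt (Icc_mem_nhds ht.1 ht.2)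
  refine ⟨h1, h2, ?_, ?_⟩
  · refine strictMonoOn_of_deriv_pos (convex_Icc 0 T) hxc ?_
    intro t ht
    rw [interior_Icc] at ht
    rw [(hda t ht).deriv]
    exact mul_pos (hVpos _) (h2 t (Ioo_subset_Icc_self ht))
  · intro f hf
    have hu : uIcc 0 T = Icc 0 T := uIcc_of_le hT.le
    rw [← intervalIntegral.integral_comp_mul_deriv'' (f := x)
      (f' := fun t => V (x t, y t) * x t)
      (g := fun u => f (u, (x 0 * y 0) / u) / (V (u, (x 0 * y 0) / u) * u))]
    · refine intervalIntegral.integral_congr ?_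
      intro t ht
      rw [hu] at ht
      have hp := h2 t ht
      have hyt : x 0 * y 0 / x t = y t := by
        rw [← h1 t ht]; field_simp
      have hV := (hVpos (x t, y t)).ne'
      simp only [Function.comp, hyt]
      field_simp
    · rwa [hu]
    · intro t ht
      rw [min_eq_left hT.le, max_eq_right hT.le] at ht
      exact (hda t ht).hasDerivWithinAt
    · rw [hu]
      exact (hVc.comp_continuousOn (hxc.prodMk hyc)).mul hxc
    · rw [hu]
      have hne : ∀ u ∈ x '' Icc 0 T, u ≠ 0 := by
        rintro u ⟨t, ht, rfl⟩
        exact (h2 t ht).ne'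
      have hc : ContinuousOn (fun u : ℝ => (u, (x 0 * y 0) / u)) (x '' Icc 0 T) :=
        continuousOn_id.prodMk (continuousOn_const.div continuousOn_id hne)
      refine (hf.comp_continuousOn hc).div ((hVc.comp_continuousOn hc).mul continuousOn_id) ?_
      intro u hu
      exact mul_ne_zero (hVpos _).ne' (hne u hu)
end
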